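/- Let d ≥ 1 and c ≥ 1 be natural numbers, let Θ be a symmetric positive definite real d×d matrix, L > 0 a real number, F : ℝ^d → Fin c a measurable function, and let μ be the multivariate Gaussian measure N(0, Θ⁻¹) on ℝ^d. Fix x ∈ ℝ^d and a class k ∈ Fin c, and suppose μ{v : F(x + v) = k} ≥ Φ(√(1/L)). Then for every δ ∈ ℝ^d with δᵀ Θ δ < 1/L, it holds that μ{v : F(x + δ + v) = k} > 1/2, and hence for every class j ≠ k, μ{v : F(x + δ + v) = j} < μ{v : F(x + δ + v) = k}. Consequently the smoothed classifier G(y) = argmax_j μ{v : F(y + v) = j} satisfies G(x + δ) = G(x) = k for all such δ, i.e., G is metrically individually fair at x: for all x', 1[G(x') ≠ G(x)] ≤ L · (x − x')ᵀ Θ (x − x'). -/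

import Mathlib

open MeasureTheory ProbabilityTheory Matrix
open scoped ENNReal

/-- The multivariate Gaussian measure `N(0, S)` on `ℝ^d`, for a (positive
definite) covariance matrix `S`, given by its density
`(2π)^{−d/2} (det S)^{−1/2} exp(−xᵀ S⁻¹ x / 2)` w.r.t. Lebesgue measure. -/
noncomputable def multivariateGaussian {d : ℕ} (S : Matrix (Fin d) (Fin d) ℝ) :
    Measure (Fin d → ℝ) :=
  volume.withDensity fun x => ENNReal.ofReal
    (Real.sqrt (((2 * Real.pi) ^ d * S.det)⁻¹) * Real.exp (-(x ⬝ᵥ S⁻¹ *ᵥ x) / 2))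

lemma aux_half {t : ℝ} (ht : 0 < t) : (1 / 2 : ℝ≥0∞) < gaussianReal 0 1 (Set.Iic t) := by
  have h1 : gaussianReal 0 1 (Set.Iic 0) = gaussianReal 0 1 (Set.Ici 0) := by
    have h := gaussianReal_map_neg (μ := 0) (v := 1)
    rw [neg_zero] at h
    conv_lhs => rw [← h]
    rw [Measure.map_apply (by fun_prop) measurableSet_Iic]
    congr 1
    ext y; simp
  have h2 : (1 : ℝ≥0∞) ≤ gaussianReal 0 1 (Set.Iic 0) + gaussianReal 0 1 (Set.Ici 0) := by
    rw [← measure_univ (μ := gaussianReal 0 1), ← Set.Iic_union_Ici (a := (0:ℝ))]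
    exact measure_union_le _ _
  have h3 : (1 / 2 : ℝ≥0∞) ≤ gaussianReal 0 1 (Set.Iic 0) := by
    rw [← h1, ← two_mul] at h2
    rw [ENNReal.div_le_iff_le_mul (by simp) (by simp), mul_comm]
    exact h2
  have h4 : gaussianReal 0 1 (Set.Ioc 0 t) ≠ 0 := by
    intro h
    have := gaussianReal_absolutelyContinuous' 0 (v := 1) one_ne_zero h
    simp at this
    linarith
  have h5 : Set.Iic t = Set.Iic 0 ∪ Set.Ioc 0 t := (Set.Iic_union_Ioc_eq_Iic ht.le).symm
  rw [h5, measure_union (Set.Iic_disjoint_Ioc le_rfl) measurableSet_Ioc]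
  refine lt_of_le_of_lt h3 (ENNReal.lt_add_right (measure_ne_top _ _) h4)

lemma aux_law {d : ℕ} (a : Fin d → ℝ) :
    (Measure.pi (fun _ : Fin d => gaussianReal 0 1)).map (fun z => a ⬝ᵥ z) =
      gaussianReal 0 (a ⬝ᵥ a).toNNReal := by
  have h := IsGaussian.map_eq_gaussianReal
    (μ := stdGaussian (EuclideanSpace ℝ (Fin d))) (innerSL ℝ (WithLp.toLp 2 a))
  rw [variance_dual_stdGaussian, integral_strongDual_stdGaussian, ← map_pi_eq_stdGaussian,
    Measure.map_map (by fun_prop) (by fun_prop), innerSL_apply_norm] at h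
  have e : ‖(WithLp.toLp 2 a : EuclideanSpace ℝ (Fin d))‖ ^ 2 = a ⬝ᵥ a := by
    rw [EuclideanSpace.norm_sq_eq]
    simp [dotProduct, sq]
  rw [e] at h
  rw [← h]
  congr 1
  ext z
  simp [dotProduct, PiLp.inner_apply, mul_comm]

lemma aux_pi (d : ℕ) : Measure.pi (fun _ : Fin d => gaussianReal 0 1) =
    (volume : Measure (Fin d → ℝ)).withDensity fun z => ENNReal.ofReal
      (Real.sqrt (((2 * Real.pi) ^ d)⁻¹) * Real.exp (-(z ⬝ᵥ z) / 2)) := by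
  have hp : ∀ z : Fin d → ℝ, Real.sqrt (((2 * Real.pi) ^ d)⁻¹) * Real.exp (-(z ⬝ᵥ z) / 2)
      = ∏ i, gaussianPDFReal 0 1 (z i) := by
    intro z
    simp only [gaussianPDFReal, Finset.prod_mul_distrib, ← Real.exp_sum]
    congr 1
    · rw [Real.sqrt_inv, Finset.prod_const]
      have hsq : Real.sqrt ((2 * Real.pi) ^ d) = Real.sqrt (2 * Real.pi) ^ d := by
        rw [Real.sqrt_eq_iff_mul_self_eq (by positivity) (by positivity), ← mul_pow,
          Real.mul_self_sqrt (by positivity)]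
      rw [hsq]
      simp only [Finset.card_univ, Fintype.card_fin, NNReal.coe_one, mul_one, inv_pow]
    · simp [dotProduct, Finset.sum_div, sq, neg_div]
  apply Measure.pi_eq
  intro s hs
  rw [withDensity_apply _ (MeasurableSet.univ_pi hs)]
  simp_rw [hp]
  have hi : ∀ i, Integrable ((s i).indicator (gaussianPDFReal 0 1)) volume := fun i =>
    (integrable_gaussianPDFReal 0 1).indicator (hs i)
  have hn : ∀ i y, 0 ≤ (s i).indicator (gaussianPDFReal 0 1) y := fun i y =>
    Set.indicator_nonneg (fun _ _ => gaussianPDFReal_nonneg _ _ _) _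
  have e1 : ∀ i, gaussianReal 0 1 (s i) =
      ENNReal.ofReal (∫ y, (s i).indicator (gaussianPDFReal 0 1) y) := by
    intro i
    rw [gaussianReal_apply_eq_integral _ one_ne_zero, integral_indicator (hs i)]
  simp_rw [e1]
  rw [← ENNReal.ofReal_prod_of_nonneg (fun i _ => integral_nonneg (hn i)),
    ← integral_fintype_prod_volume_eq_prod (𝕜 := ℝ)
      (fun i => (s i).indicator (gaussianPDFReal 0 1)),
    ofReal_integral_eq_lintegral_ofReal (by
      exact Integrable.fintype_prod hi)
      (Filter.Eventually.of_forall fun z => Finset.prod_nonneg fun i _ => hn i _),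
    ← lintegral_indicator (MeasurableSet.univ_pi hs)]
  congr 1
  ext z
  by_cases hz : z ∈ Set.univ.pi s
  · rw [Set.indicator_of_mem hz]
    congr 1
    exact Finset.prod_congr rfl fun i _ => (Set.indicator_of_mem (hz i trivial) _).symm
  · rw [Set.indicator_of_notMem hz]
    simp only [Set.mem_pi, Set.mem_univ, true_implies, not_forall] at hz
    obtain ⟨i, hi⟩ := hz
    rw [Finset.prod_eq_zero (Finset.mem_univ i) (Set.indicator_of_notMem hi _)]
    simp

lemma aux_quad {d : ℕ} (M : Matrix (Fin d) (Fin d) ℝ) (u v : Fin d → ℝ) :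
    u ⬝ᵥ (Mᵀ * M) *ᵥ v = (M *ᵥ u) ⬝ᵥ (M *ᵥ v) := by
  rw [← mulVec_mulVec, dotProduct_mulVec, vecMul_transpose]

lemma aux_map {d : ℕ} (M : Matrix (Fin d) (Fin d) ℝ) (hM : M.det ≠ 0) :
    (_root_.multivariateGaussian (Mᵀ * M)⁻¹).map (fun u => M *ᵥ u) =
      Measure.pi (fun _ : Fin d => gaussianReal 0 1) := by
  have hm : Measurable (fun u : Fin d → ℝ => M *ᵥ u) := by
    have : Continuous (fun u : Fin d → ℝ => M *ᵥ u) := by fun_prop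
    exact this.measurable
  have hu : IsUnit (Mᵀ * M).det := by
    rw [det_mul, det_transpose]; exact (mul_ne_zero hM hM).isUnit
  rw [aux_pi]
  ext s hs
  rw [Measure.map_apply hm hs, _root_.multivariateGaussian, withDensity_apply _ (hm hs),
    withDensity_apply _ hs, nonsing_inv_nonsing_inv _ hu]
  simp_rw [aux_quad]
  have hvol := Real.map_matrix_volume_pi_eq_smul_volume_pi hM
  set g : (Fin d → ℝ) → ℝ≥0∞ := fun z => ENNReal.ofReal
      (Real.sqrt (((2 * Real.pi) ^ d)⁻¹) * Real.exp (-(z ⬝ᵥ z) / 2)) with hg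
  have hgm : Measurable g := by
    apply Measurable.ennreal_ofReal
    apply Continuous.measurable
    fun_prop
  have e : ∀ u : Fin d → ℝ, ENNReal.ofReal (Real.sqrt (((2 * Real.pi) ^ d * (Mᵀ * M)⁻¹.det)⁻¹) *
      Real.exp (-((M *ᵥ u) ⬝ᵥ (M *ᵥ u)) / 2)) = ENNReal.ofReal |M.det| * g (M *ᵥ u) := by
    intro u
    rw [hg, ← ENNReal.ofReal_mul (abs_nonneg _), ← mul_assoc]
    congr 2
    rw [det_nonsing_inv, Ring.inverse_eq_inv', det_mul, det_transpose, mul_inv, inv_inv,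
      Real.sqrt_mul (by positivity), Real.sqrt_mul_self_eq_abs, mul_comm]
  simp_rw [e]
  rw [lintegral_const_mul _ (show Measurable fun u => g (M *ᵥ u) from hgm.comp hm)]
  have h2 : ∫⁻ u in (fun u => M *ᵥ u) ⁻¹' s, g (M *ᵥ u) =
      ∫⁻ z in s, g z ∂(Measure.map (toLin' M) volume) := by
    rw [setLIntegral_map hs hgm (by exact hm)]
    rfl
  rw [h2, hvol, Measure.restrict_smul, lintegral_smul_measure, smul_eq_mul, ← mul_assoc,
    ← ENNReal.ofReal_mul (abs_nonneg _), ← abs_mul, mul_inv_cancel₀ hM]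
  simp

lemma aux_sqrt {d : ℕ} (Θ : Matrix (Fin d) (Fin d) ℝ) (hΘ : Θ.PosDef) :
    ∃ M : Matrix (Fin d) (Fin d) ℝ, M.det ≠ 0 ∧ Θ = Mᵀ * M := by
  open scoped MatrixOrder in
  obtain ⟨M, hM⟩ := (CStarAlgebra.nonneg_iff_eq_star_mul_self).1 hΘ.posSemidef.nonneg
  have hM' : Θ = Mᵀ * M := by rw [hM, star_eq_conjTranspose, conjTranspose_eq_transpose_of_trivial]
  refine ⟨M, fun h => ?_, hM'⟩
  have := hΘ.det_pos
  rw [hM', det_mul, h] at this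
  simp at this

lemma aux_gauss_scale {s r : ℝ} (hs : 0 < s) :
    gaussianReal 0 (s ^ 2).toNNReal (Set.Iic (s * r)) = gaussianReal 0 1 (Set.Iic r) := by
  have h := gaussianReal_map_const_mul (μ := 0) (v := 1) s
  have e : (s ^ 2).toNNReal = NNReal.mk (s ^ 2) (sq_nonneg s) * 1 := by
    ext; simp [sq_nonneg]
  rw [mul_zero] at h
  rw [e, ← h, Measure.map_apply (by fun_prop) measurableSet_Iic]
  congr 1
  ext y
  exact mul_le_mul_iff_right₀ hs

/-- Neyman and Pearson exchange. -/
lemma aux_np {α : Type*} [MeasurableSpace α] (μ ν : Measure α) [IsFiniteMeasure μ]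
    (κ : ℝ≥0∞) (A H : Set α) (hA : MeasurableSet A) (hH : MeasurableSet H)
    (h1 : ∀ S, MeasurableSet S → S ⊆ H → ν S ≤ κ * μ S)
    (h2 : ∀ S, MeasurableSet S → S ⊆ Hᶜ → κ * μ S ≤ ν S)
    (h : μ H ≤ μ A) : ν H ≤ ν A := by
  have h3 : μ (H \ A) ≤ μ (A \ H) := by
    rw [← measure_inter_add_sdiff H hA, ← measure_inter_add_sdiff A hH, Set.inter_comm] at h
    exact (ENNReal.add_le_add_iff_left (measure_ne_top _ _)).1 h
  rw [← measure_inter_add_sdiff H hA, ← measure_inter_add_sdiff A hH, Set.inter_comm]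
  refine add_le_add le_rfl ?_
  calc ν (H \ A) ≤ κ * μ (H \ A) := h1 _ (hH.diff hA) Set.sdiff_subset
    _ ≤ κ * μ (A \ H) := by gcongr
    _ ≤ ν (A \ H) := h2 _ (hA.diff hH) (fun x hx => hx.2)

lemma aux_prob {d : ℕ} (Θ : Matrix (Fin d) (Fin d) ℝ) (hΘ : Θ.PosDef) :
    IsProbabilityMeasure (_root_.multivariateGaussian Θ⁻¹) := by
  obtain ⟨M, hM, rfl⟩ := aux_sqrt Θ hΘ
  have h := aux_map M hM
  have hm : Measurable (fun u : Fin d → ℝ => M *ᵥ u) := by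
    have : Continuous (fun u : Fin d → ℝ => M *ᵥ u) := by fun_prop
    exact this.measurable
  constructor
  have := measure_univ (μ := Measure.pi (fun _ : Fin d => gaussianReal 0 1))
  rw [← h, Measure.map_apply hm MeasurableSet.univ] at this
  simpa using this

lemma aux_lin {d : ℕ} (Θ : Matrix (Fin d) (Fin d) ℝ) (hΘ : Θ.PosDef) (δ : Fin d → ℝ) :
    (_root_.multivariateGaussian Θ⁻¹).map (fun u => δ ⬝ᵥ Θ *ᵥ u) =
      gaussianReal 0 (δ ⬝ᵥ Θ *ᵥ δ).toNNReal := by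
  obtain ⟨M, hM, rfl⟩ := aux_sqrt Θ hΘ
  have hm : Measurable (fun u : Fin d → ℝ => M *ᵥ u) := by
    have : Continuous (fun u : Fin d → ℝ => M *ᵥ u) := by fun_prop
    exact this.measurable
  have hm2 : Measurable (fun z : Fin d → ℝ => (M *ᵥ δ) ⬝ᵥ z) := by
    have : Continuous (fun z : Fin d → ℝ => (M *ᵥ δ) ⬝ᵥ z) := by fun_prop
    exact this.measurable
  rw [aux_quad, ← aux_law, ← aux_map M hM, Measure.map_map hm2 hm]
  congr 1
  ext u
  simp [aux_quad]

lemma aux_shift {d : ℕ} (Θ : Matrix (Fin d) (Fin d) ℝ) (hΘ : Θ.PosDef) (δ : Fin d → ℝ)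
    (S : Set (Fin d → ℝ)) (hS : MeasurableSet S) :
    (_root_.multivariateGaussian Θ⁻¹).map (fun v => δ + v) S =
      ∫⁻ u in S, ENNReal.ofReal (Real.exp (δ ⬝ᵥ Θ *ᵥ u - δ ⬝ᵥ Θ *ᵥ δ / 2))
        ∂(_root_.multivariateGaussian Θ⁻¹) := by
  have hu : IsUnit Θ.det := hΘ.det_pos.ne'.isUnit
  have hsym : ∀ u v : Fin d → ℝ, u ⬝ᵥ Θ *ᵥ v = v ⬝ᵥ Θ *ᵥ u := by
    obtain ⟨M, hM, rfl⟩ := aux_sqrt Θ hΘ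
    intro u v
    rw [aux_quad, aux_quad, dotProduct_comm]
  have hm : Measurable (fun v : Fin d → ℝ => δ + v) := by fun_prop
  set C := Real.sqrt (((2 * Real.pi) ^ d * Θ⁻¹.det)⁻¹) with hC
  set p : (Fin d → ℝ) → ℝ≥0∞ := fun u => ENNReal.ofReal (C * Real.exp (-(u ⬝ᵥ Θ *ᵥ u) / 2))
    with hp
  have hpm : Measurable p := by
    apply Measurable.ennreal_ofReal
    apply Continuous.measurable
    fun_prop
  have hqm : Measurable fun u => ENNReal.ofReal (Real.exp (δ ⬝ᵥ Θ *ᵥ u - δ ⬝ᵥ Θ *ᵥ δ / 2)) := by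
    apply Measurable.ennreal_ofReal
    apply Continuous.measurable
    fun_prop
  have hμ : _root_.multivariateGaussian Θ⁻¹ = volume.withDensity p := by
    rw [_root_.multivariateGaussian, nonsing_inv_nonsing_inv _ hu]
  rw [hμ, Measure.map_apply hm hS, withDensity_apply _ (hm hS),
    setLIntegral_withDensity_eq_setLIntegral_mul _ hpm hqm hS]
  have h2 : ∫⁻ v in (fun v => δ + v) ⁻¹' S, p v = ∫⁻ u in S, p (u - δ) := by
    have := (measurePreserving_add_left (volume : Measure (Fin d → ℝ)) δ).setLIntegral_comp_preimage
      hS (f := fun u => p (u - δ)) (by fun_prop)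
    simpa using this
  rw [h2]
  congr 1
  ext u
  simp only [hp, Pi.mul_apply]
  rw [← ENNReal.ofReal_mul (by positivity), mul_assoc, ← Real.exp_add]
  congr 3
  simp only [mulVec_sub, dotProduct_sub, sub_dotProduct, hsym u δ]
  ring

lemma aux_main {d : ℕ} (Θ : Matrix (Fin d) (Fin d) ℝ) (hΘ : Θ.PosDef) (δ : Fin d → ℝ)
    (r : ℝ) (hr : 0 < r) (hδ : δ ⬝ᵥ Θ *ᵥ δ < r ^ 2)
    (A : Set (Fin d → ℝ)) (hA : MeasurableSet A)
    (h : gaussianReal 0 1 (Set.Iic r) ≤ _root_.multivariateGaussian Θ⁻¹ A) :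
    (1 / 2 : ℝ≥0∞) < _root_.multivariateGaussian Θ⁻¹ ((fun v => δ + v) ⁻¹' A) := by
  have := aux_prob Θ hΘ
  by_cases h0 : δ = 0
  · subst h0
    simpa using lt_of_lt_of_le (aux_half hr) h
  have hq : 0 < δ ⬝ᵥ Θ *ᵥ δ := by simpa using hΘ.dotProduct_mulVec_pos h0
  obtain ⟨s, hs, hsq⟩ : ∃ s : ℝ, 0 < s ∧ δ ⬝ᵥ Θ *ᵥ δ = s ^ 2 :=
    ⟨_, Real.sqrt_pos.2 hq, (Real.sq_sqrt hq.le).symm⟩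
  have hsr : s < r := by
    rw [hsq] at hδ
    exact lt_of_pow_lt_pow_left₀ 2 hr.le hδ
  have hm : Measurable (fun v : Fin d → ℝ => δ + v) := by fun_prop
  have hl : Measurable (fun u : Fin d → ℝ => δ ⬝ᵥ Θ *ᵥ u) := by
    apply Continuous.measurable
    fun_prop
  have hlaw := aux_lin Θ hΘ δ
  rw [hsq] at hlaw
  have hIic : ∀ t : ℝ, _root_.multivariateGaussian Θ⁻¹ {u | δ ⬝ᵥ Θ *ᵥ u ≤ s * t} =
      gaussianReal 0 1 (Set.Iic t) := by
    intro t
    rw [← aux_gauss_scale hs, ← hlaw, Measure.map_apply hl measurableSet_Iic]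
    rfl
  set H : Set (Fin d → ℝ) := {u | δ ⬝ᵥ Θ *ᵥ u ≤ s * r} with hH
  have hHm : MeasurableSet H := hl measurableSet_Iic
  have key := aux_np (_root_.multivariateGaussian Θ⁻¹)
    ((_root_.multivariateGaussian Θ⁻¹).map (fun v => δ + v))
    (ENNReal.ofReal (Real.exp (s * r - s ^ 2 / 2))) A H hA hHm ?_ ?_ ((hIic r).trans_le h)
  · rw [Measure.map_apply hm hHm, Measure.map_apply hm hA] at key
    refine lt_of_lt_of_le ?_ key
    have e : (fun v => δ + v) ⁻¹' H = {u | δ ⬝ᵥ Θ *ᵥ u ≤ s * (r - s)} := by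
      ext v
      simp only [hH, Set.mem_preimage, Set.mem_ofPred_eq, mulVec_add, dotProduct_add, hsq]
      constructor <;> intro _ <;> nlinarith
    rw [e, hIic]
    exact aux_half (by linarith)
  · intro S hS hSH
    rw [aux_shift Θ hΘ δ S hS, hsq, ← setLIntegral_const]
    refine setLIntegral_mono measurable_const fun u hu => ?_
    have := hSH hu
    simp only [hH, Set.mem_ofPred_eq] at this
    gcongr
  · intro S hS hSH
    rw [aux_shift Θ hΘ δ S hS, hsq, ← setLIntegral_const]
    refine setLIntegral_mono ?_ fun u hu => ?_
    · apply Measurable.ennreal_ofReal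
      apply Continuous.measurable
      fun_prop
    have := hSH hu
    simp only [hH, Set.mem_compl_iff, Set.mem_ofPred_eq, not_le] at this
    gcongr

/-- Fairness via Mahalanobis randomized smoothing: if under Gaussian noise
`N(0, Θ⁻¹)` the base classifier `F` predicts class `k` at `x` with probability
at least `Φ(√(1/L))`, then for every `δ` with `δᵀ Θ δ < 1/L` class `k` has
probability `> 1/2` at `x + δ` and beats every other class; consequently any
smoothed classifier `G` (picking a most probable class of `F` under the noise)
satisfies `G (x + δ) = G x = k` for all such `δ` and is metrically individually
fair at `x`. -/
theorem stmt_16 (d c : ℕ) (hd : 1 ≤ d) (hc : 1 ≤ c)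
    (Θ : Matrix (Fin d) (Fin d) ℝ) (hΘ : Θ.PosDef)
    (L : ℝ) (hL : 0 < L)
    (F : (Fin d → ℝ) → Fin c) (hF : Measurable F)
    (μ : Measure (Fin d → ℝ)) (hμ : μ = multivariateGaussian Θ⁻¹)
    (x : Fin d → ℝ) (k : Fin c)
    (hk : ENNReal.ofReal (cdf (gaussianReal 0 1) (Real.sqrt (1 / L))) ≤
      μ {v | F (x + v) = k})
    (G : (Fin d → ℝ) → Fin c)
    (hG : ∀ y : Fin d → ℝ, ∀ j : Fin c,
      μ {v | F (y + v) = j} ≤ μ {v | F (y + v) = G y}) :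
    (∀ δ : Fin d → ℝ, δ ⬝ᵥ Θ *ᵥ δ < 1 / L →
      (1 / 2 : ℝ≥0∞) < μ {v | F (x + δ + v) = k} ∧
      ∀ j : Fin c, j ≠ k →
        μ {v | F (x + δ + v) = j} < μ {v | F (x + δ + v) = k}) ∧
    G x = k ∧
    (∀ δ : Fin d → ℝ, δ ⬝ᵥ Θ *ᵥ δ < 1 / L → G (x + δ) = k) ∧
    (∀ x' : Fin d → ℝ,
      (if G x' ≠ G x then (1 : ℝ) else 0) ≤ L * ((x - x') ⬝ᵥ Θ *ᵥ (x - x'))) := by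
  have hp : IsProbabilityMeasure μ := hμ ▸ aux_prob Θ hΘ
  have hr : 0 < Real.sqrt (1 / L) := Real.sqrt_pos.2 (by positivity)
  have hr2 : Real.sqrt (1 / L) ^ 2 = 1 / L := Real.sq_sqrt (by positivity)
  rw [ofReal_cdf] at hk
  have hms : ∀ (y : Fin d → ℝ) (j : Fin c), MeasurableSet {v | F (y + v) = j} := fun y j => by
    have : Measurable fun v => F (y + v) := hF.comp (by fun_prop)
    exact this (measurableSet_singleton j)
  have h1 : ∀ δ : Fin d → ℝ, δ ⬝ᵥ Θ *ᵥ δ < 1 / L →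
      (1 / 2 : ℝ≥0∞) < μ {v | F (x + δ + v) = k} := by
    intro δ hδ
    have := aux_main Θ hΘ δ _ hr (by rw [hr2]; exact hδ) _ (hms x k) (hμ ▸ hk)
    rw [hμ]
    simpa [add_assoc] using this
  have h2 : ∀ δ : Fin d → ℝ, δ ⬝ᵥ Θ *ᵥ δ < 1 / L → ∀ j : Fin c, j ≠ k →
        μ {v | F (x + δ + v) = j} < μ {v | F (x + δ + v) = k} := by
    intro δ hδ j hj
    have hlt := h1 δ hδ
    by_contra! hle
    have hd : Disjoint {v | F (x + δ + v) = j} {v | F (x + δ + v) = k} := by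
      rw [Set.disjoint_left]
      intro v hv hv'
      exact hj (hv.symm.trans hv')
    have hsum := measure_union (μ := μ) hd (hms _ k)
    have hle1 := prob_le_one (μ := μ) (s := {v | F (x + δ + v) = j} ∪ {v | F (x + δ + v) = k})
    rw [hsum] at hle1
    have : (1 / 2 : ℝ≥0∞) + 1 / 2 < 1 :=
      lt_of_lt_of_le (ENNReal.add_lt_add (hlt.trans_le hle) hlt) hle1
    rw [ENNReal.add_halves] at this
    exact lt_irrefl _ this
  have h3 : ∀ δ : Fin d → ℝ, δ ⬝ᵥ Θ *ᵥ δ < 1 / L → G (x + δ) = k := by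
    intro δ hδ
    by_contra hne
    exact absurd (hG (x + δ) k) (not_le.2 (h2 δ hδ _ hne))
  have h4 : G x = k := by
    have := h3 0 (by simpa using hL)
    simpa using this
  refine ⟨fun δ hδ => ⟨h1 δ hδ, h2 δ hδ⟩, h4, h3, fun x' => ?_⟩
  have hsymm : (x - x') ⬝ᵥ Θ *ᵥ (x - x') = (x' - x) ⬝ᵥ Θ *ᵥ (x' - x) := by
    rw [← neg_sub x' x, mulVec_neg, neg_dotProduct_neg]
  rw [hsymm]
  have hnn : 0 ≤ (x' - x) ⬝ᵥ Θ *ᵥ (x' - x) := by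
    simpa using hΘ.posSemidef.dotProduct_mulVec_nonneg (x' - x)
  split_ifs with hne
  · by_contra! hlt
    apply hne
    rw [h4]
    have := h3 (x' - x) (by rw [lt_div_iff₀ hL]; linarith)
    simpa using this
  · positivity
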